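/- arXiv:2011.00354 — 2 statements merged into one kernel-verified Lean document; each statement's English description precedes it below -/
import Mathlib

section
/- Let 1 < p ≤ 2 and f_p(x) := |x|^p. For all nonzero real r, s with r ≠ s: if rs > 0 then f_p^{[2]}(r,s,r) + f_p^{[2]}(s,r,s) = p(|r|^{p−1} − |s|^{p−1})/(|r| − |s|), and if rs < 0 then f_p^{[2]}(r,s,r) + f_p^{[2]}(s,r,s) = p(|r|^{p−1} + |s|^{p−1})/(|r| + |s|). -/
/-- First divided difference: `f^{[1]}(r,s) = (f r - f s)/(r - s)` for `r ≠ s`,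
and `f'(r)` for `r = s`. -/
noncomputable def dd1 (f : ℝ → ℝ) (r s : ℝ) : ℝ :=
  if r = s then deriv f r else (f r - f s) / (r - s)

/-- Second divided difference: `f^{[2]}(r,s,t) = (f^{[1]}(r,s) - f^{[1]}(r,t))/(s - t)`
for `s ≠ t`, and `(∂/∂λ)|_{λ=s} f^{[1]}(r,λ)` for `s = t`. -/
noncomputable def dd2 (f : ℝ → ℝ) (r s t : ℝ) : ℝ :=
  if s = t then deriv (fun x => dd1 f r x) s else (dd1 f r s - dd1 f r t) / (s - t)

/-- Both `dd2 f r s r` and `dd2 f s r s` involve the same first divided difference, which cancels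
in their sum. -/
theorem dd2_add_dd2_swap (f : ℝ → ℝ) {r s : ℝ} (hrs : r ≠ s) :
    dd2 f r s r + dd2 f s r s = (deriv f r - deriv f s) / (r - s) := by
  have h₁ : r - s ≠ 0 := sub_ne_zero.mpr hrs
  have h₂ : s - r ≠ 0 := sub_ne_zero.mpr hrs.symm
  simp only [dd2, dd1, hrs, hrs.symm, if_true, if_false]
  rw [← neg_sub r s, ← neg_sub (f r) (f s)]
  field_simp
  ring

theorem deriv_abs_rpow_of_pos (p : ℝ) {x : ℝ} (hx : 0 < x) :
    deriv (fun y : ℝ => |y| ^ p) x = p * |x| ^ (p - 1) := by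
  have h := (hasDerivAt_abs_pos hx).rpow_const (p := p) (Or.inl (abs_ne_zero.mpr hx.ne'))
  rw [h.deriv, one_mul]

theorem deriv_abs_rpow_of_neg (p : ℝ) {x : ℝ} (hx : x < 0) :
    deriv (fun y : ℝ => |y| ^ p) x = -(p * |x| ^ (p - 1)) := by
  have h := (hasDerivAt_abs_neg hx).rpow_const (p := p) (Or.inl (abs_ne_zero.mpr hx.ne))
  rw [h.deriv, neg_one_mul, neg_mul]

/-- For `1 < p ≤ 2`, `f_p(x) = |x|^p` and nonzero `r ≠ s`:
if `rs > 0` then `f_p^{[2]}(r,s,r) + f_p^{[2]}(s,r,s) = p(|r|^{p−1} − |s|^{p−1})/(|r| − |s|)`,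
and if `rs < 0` then it equals `p(|r|^{p−1} + |s|^{p−1})/(|r| + |s|)`.
(If `rs > 0` and `r ≠ s` then `|r| ≠ |s|`, so the quotient case is the only one arising.) -/
theorem dd2_abs_rpow_sum_cases (p : ℝ) (hp1 : 1 < p) (hp2 : p ≤ 2) (r s : ℝ)
    (hr : r ≠ 0) (hs : s ≠ 0) (hrs : r ≠ s) :
    (r * s > 0 →
      dd2 (fun x => |x| ^ p) r s r + dd2 (fun x => |x| ^ p) s r s =
        p * (|r| ^ (p - 1) - |s| ^ (p - 1)) / (|r| - |s|)) ∧
    (r * s < 0 →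
      dd2 (fun x => |x| ^ p) r s r + dd2 (fun x => |x| ^ p) s r s =
        p * (|r| ^ (p - 1) + |s| ^ (p - 1)) / (|r| + |s|)) := by
  rw [dd2_add_dd2_swap _ hrs]
  refine ⟨fun h => ?_, fun h => ?_⟩
  · rcases mul_pos_iff.mp h with ⟨hr, hs⟩ | ⟨hr, hs⟩
    · rw [deriv_abs_rpow_of_pos p hr, deriv_abs_rpow_of_pos p hs, mul_sub]
      congr 1
      rw [abs_of_pos hr, abs_of_pos hs]
    · rw [deriv_abs_rpow_of_neg p hr, deriv_abs_rpow_of_neg p hs, ← neg_div_neg_eq]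
      congr 1
      · ring
      · rw [abs_of_neg hr, abs_of_neg hs]
        ring
  · rcases mul_neg_iff.mp h with ⟨hr, hs⟩ | ⟨hr, hs⟩
    · rw [deriv_abs_rpow_of_pos p hr, deriv_abs_rpow_of_neg p hs]
      congr 1
      · ring
      · rw [abs_of_pos hr, abs_of_neg hs]
        ring
    · rw [deriv_abs_rpow_of_neg p hr, deriv_abs_rpow_of_pos p hs, ← neg_div_neg_eq]
      congr 1
      · ring
      · rw [abs_of_neg hr, abs_of_pos hs]
        ring
end

section
/- Let A and B be self-adjoint n × n complex matrices and let f be a twice continuously differentiable function on an open set Ω ⊆ ℝ containing the spectrum of A + tB for all sufficiently small |t|. Then t ↦ f(A + tB) (via functional calculus) is twice differentiable at t = 0 and (d²/dt²)|_{t=0} f(A + tB) = 2 Σ_{i,j,k} f^{[2]}(λ_i, λ_j, λ_k) E_i^A B E_j^A B E_k^A, where A = Σ_i λ_i E_i^A is the spectral decomposition of A. -/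
open scoped BigOperators Matrix

attribute [local instance] Matrix.normedAddCommGroup Matrix.normedSpace

/-- The sum of a Hermitian matrix and a real multiple of a Hermitian matrix is Hermitian. -/
theorem isHermitian_add_smul {k : ℕ} {A B : Matrix (Fin k) (Fin k) ℂ}
    (hA : A.IsHermitian) (hB : B.IsHermitian) (t : ℝ) : (A + t • B).IsHermitian := by
  rw [Matrix.IsHermitian, Matrix.conjTranspose_add, Matrix.conjTranspose_smul, star_trivial,
    hA.eq, hB.eq]

/-- Application of a real function `f` to a Hermitian matrix via the functional calculus:
`f(A) = U · diag(f(λ_i)) · U*` where `A = U · diag(λ_i) · U*` is a spectral decomposition. -/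
noncomputable def hermApply (f : ℝ → ℝ) {k : ℕ} {A : Matrix (Fin k) (Fin k) ℂ}
    (hA : A.IsHermitian) : Matrix (Fin k) (Fin k) ℂ :=
  (hA.eigenvectorUnitary : Matrix (Fin k) (Fin k) ℂ) *
    Matrix.diagonal (fun i => (f (hA.eigenvalues i) : ℂ)) *
    (star (hA.eigenvectorUnitary : Matrix (Fin k) (Fin k) ℂ))

open Filter Topology

theorem dd1_comm (f : ℝ → ℝ) (r s : ℝ) : dd1 f r s = dd1 f s r := by
  unfold dd1
  split_ifs with h₁ h₂ h₂
  · rw [h₁]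
  · exact absurd h₁.symm h₂
  · exact absurd h₂.symm h₁
  · rw [← neg_sub (f s), ← neg_sub s, neg_div_neg_eq]

theorem dd1_mul_sub (f : ℝ → ℝ) (r s : ℝ) : dd1 f r s * (r - s) = f r - f s := by
  unfold dd1
  split_ifs with h
  · simp [h]
  · exact div_mul_cancel₀ _ (sub_ne_zero.2 h)

theorem dd2_mul_sub (f : ℝ → ℝ) (r s t : ℝ) :
    dd2 f r s t * (s - t) = dd1 f r s - dd1 f r t := by
  unfold dd2
  split_ifs with h
  · simp [h]
  · exact div_mul_cancel₀ _ (sub_ne_zero.2 h)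

theorem dd1_eq_integral {f : ℝ → ℝ} (hf : ContDiff ℝ 1 f) (r s : ℝ) :
    dd1 f r s = ∫ u in (0 : ℝ)..1, deriv f (r + u * (s - r)) := by
  unfold dd1
  split_ifs with h
  · simp [h]
  · have hd : ∀ u ∈ Set.uIcc (0 : ℝ) 1, HasDerivAt (fun u => f (r + u * (s - r)))
        (deriv f (r + u * (s - r)) * (s - r)) u := by
      intro u _
      have h1 : HasDerivAt (fun u : ℝ => r + u * (s - r)) (s - r) u := by
        simpa using ((hasDerivAt_id u).mul_const (s - r)).const_add r
      exact ((hf.differentiable one_ne_zero _).hasDerivAt).comp u h1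
    have hc : Continuous fun u : ℝ => deriv f (r + u * (s - r)) * (s - r) :=
      ((hf.continuous_deriv le_rfl).comp (by fun_prop)).mul continuous_const
    have := intervalIntegral.integral_eq_sub_of_hasDerivAt hd (hc.intervalIntegrable 0 1)
    rw [intervalIntegral.integral_mul_const] at this
    rw [div_eq_iff (sub_ne_zero.2 h)]
    simp only [one_mul, add_sub_cancel, zero_mul, add_zero] at this
    linear_combination this

theorem continuous_dd1 {f : ℝ → ℝ} (hf : ContDiff ℝ 1 f) :
    Continuous fun p : ℝ × ℝ => dd1 f p.1 p.2 := by
  simp_rw [dd1_eq_integral hf]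
  refine intervalIntegral.continuous_parametric_intervalIntegral_of_continuous' ?_ 0 1
  exact (hf.continuous_deriv le_rfl).comp (by fun_prop)

theorem ContDiff.deriv_of_two {f : ℝ → ℝ} (hf : ContDiff ℝ 2 f) : ContDiff ℝ 1 (deriv f) :=
  (contDiff_succ_iff_deriv (n := 1).1 (by simpa [one_add_one_eq_two] using hf)).2.2

theorem continuous_dd2_integral {f : ℝ → ℝ} (hf : ContDiff ℝ 2 f) :
    Continuous fun p : ℝ × ℝ × ℝ => ∫ u in (0 : ℝ)..1,
      u * dd1 (deriv f) (p.1 + u * (p.2.1 - p.1)) (p.1 + u * (p.2.2 - p.1)) := by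
  refine intervalIntegral.continuous_parametric_intervalIntegral_of_continuous' ?_ 0 1
  have h := continuous_dd1 hf.deriv_of_two
  refine Continuous.mul (by fun_prop) (h.comp (f := fun q : (ℝ × ℝ × ℝ) × ℝ =>
    (q.1.1 + q.2 * (q.1.2.1 - q.1.1), q.1.1 + q.2 * (q.1.2.2 - q.1.1))) (by fun_prop))

theorem dd2_integral_mul_sub {f : ℝ → ℝ} (hf : ContDiff ℝ 2 f) (r s t : ℝ) :
    (∫ u in (0 : ℝ)..1, u * dd1 (deriv f) (r + u * (s - r)) (r + u * (t - r))) * (s - t) =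
      dd1 f r s - dd1 f r t := by
  have hf1 : ContDiff ℝ 1 f := hf.of_le one_le_two
  have hc : ∀ x : ℝ, Continuous fun u : ℝ => deriv f (r + u * (x - r)) := fun x =>
    (hf1.continuous_deriv le_rfl).comp (by fun_prop)
  rw [dd1_eq_integral hf1, dd1_eq_integral hf1, ← intervalIntegral.integral_sub
    ((hc s).intervalIntegrable _ _) ((hc t).intervalIntegrable _ _),
    ← intervalIntegral.integral_mul_const]
  refine intervalIntegral.integral_congr fun u _ => ?_
  have := dd1_mul_sub (deriv f) (r + u * (s - r)) (r + u * (t - r))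
  linear_combination this

theorem dd2_eq_integral {f : ℝ → ℝ} (hf : ContDiff ℝ 2 f) (r s t : ℝ) :
    dd2 f r s t =
      ∫ u in (0 : ℝ)..1, u * dd1 (deriv f) (r + u * (s - r)) (r + u * (t - r)) := by
  rcases eq_or_ne s t with rfl | h
  · rw [dd2, if_pos rfl]
    refine HasDerivAt.deriv ?_
    rw [hasDerivAt_iff_tendsto_slope]
    have hc : Tendsto (fun x : ℝ => ∫ u in (0 : ℝ)..1,
        u * dd1 (deriv f) (r + u * (x - r)) (r + u * (s - r))) (𝓝[≠] s) (𝓝 (∫ u in (0 : ℝ)..1,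
        u * dd1 (deriv f) (r + u * (s - r)) (r + u * (s - r)))) :=
      (((continuous_dd2_integral hf).comp (f := fun x : ℝ => (r, x, s))
        (by fun_prop)).tendsto s).mono_left nhdsWithin_le_nhds
    refine hc.congr' ?_
    filter_upwards [self_mem_nhdsWithin] with x hx
    rw [slope_def_field, eq_div_iff (sub_ne_zero.2 hx), dd2_integral_mul_sub hf]
  · exact mul_right_cancel₀ (sub_ne_zero.2 h)
      ((dd2_mul_sub f r s t).trans (dd2_integral_mul_sub hf r s t).symm)

theorem continuous_dd2 {f : ℝ → ℝ} (hf : ContDiff ℝ 2 f) :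
    Continuous fun p : ℝ × ℝ × ℝ => dd2 f p.1 p.2.1 p.2.2 := by
  simp_rw [dd2_eq_integral hf]
  exact continuous_dd2_integral hf

theorem dd2_swap {f : ℝ → ℝ} (hf : ContDiff ℝ 2 f) (r s t : ℝ) : dd2 f r s t = dd2 f r t s := by
  rw [dd2_eq_integral hf, dd2_eq_integral hf]
  simp_rw [dd1_comm (deriv f) (r + _ * (s - r))]

theorem dd2_rotate_of_ne {f : ℝ → ℝ} {r s t : ℝ} (hrs : r ≠ s) (hst : s ≠ t) (hrt : r ≠ t) :
    dd2 f t r s = dd2 f r s t := by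
  have h1 := sub_ne_zero.2 hrs
  have h2 := sub_ne_zero.2 hst
  have h3 := sub_ne_zero.2 hrt
  have h4 := sub_ne_zero.2 hrt.symm
  have h5 := sub_ne_zero.2 hst.symm
  simp only [dd2, dd1, hrs, hst, hrt, hrt.symm, hst.symm, if_false]
  field_simp
  ring

theorem dd2_rotate {f : ℝ → ℝ} (hf : ContDiff ℝ 2 f) (r s t : ℝ) :
    dd2 f t r s = dd2 f r s t := by
  have hc := continuous_dd2 hf
  have hne : ∀ {r t : ℝ}, r ≠ t → ∀ s, dd2 f t r s = dd2 f r s t := by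
    intro r t h
    refine congrFun (Continuous.ext_on ((Set.toFinite {r, t}).countable.dense_compl ℝ)
      (hc.comp (f := fun s : ℝ => (t, r, s)) (by fun_prop))
      (hc.comp (f := fun s : ℝ => (r, s, t)) (by fun_prop)) fun s hs => ?_)
    simp only [Set.mem_compl_iff, Set.mem_insert_iff, Set.mem_singleton_iff, not_or] at hs
    exact dd2_rotate_of_ne (Ne.symm hs.1) hs.2 h
  exact congrFun (Continuous.ext_on (dense_compl_singleton t)
    (hc.comp (f := fun r : ℝ => (t, r, s)) (by fun_prop))
    (hc.comp (f := fun r : ℝ => (r, s, t)) (by fun_prop)) fun r hr => hne hr s) r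

/-- `P` is a complete family of orthogonal idempotents diagonalizing `X`, with real
eigenvalues `x`. The `P i` may vanish and the `x i` may coincide. -/
structure IsSpectralResolution {M ι : Type*} [Ring M] [Algebra ℝ M] [Fintype ι] [DecidableEq ι]
    (X : M) (P : ι → M) (x : ι → ℝ) : Prop where
  mul_eq : ∀ i j, P i * P j = if i = j then P i else 0
  sum_eq : ∑ i, P i = 1
  left_mul : ∀ i, X * P i = x i • P i
  right_mul : ∀ i, P i * X = x i • P i

namespace IsSpectralResolution

variable {M ι κ μ : Type*} [Ring M] [Algebra ℝ M] [Fintype ι] [DecidableEq ι]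
  [Fintype κ] [DecidableEq κ] [Fintype μ] {X Y : M} {P : ι → M} {x : ι → ℝ}
  {Q : κ → M} {y : κ → ℝ}

theorem of_eq_sum (hmul : ∀ i j, P i * P j = if i = j then P i else 0) (hsum : ∑ i, P i = 1)
    (hX : X = ∑ i, x i • P i) : IsSpectralResolution X P x where
  mul_eq := hmul
  sum_eq := hsum
  left_mul i := by simp [hX, Finset.sum_mul, hmul]
  right_mul i := by simp [hX, Finset.mul_sum, hmul]

theorem mul_sub_mul (hP : IsSpectralResolution X P x) (hQ : IsSpectralResolution Y Q y)
    (i : ι) (j : κ) : P i * (X - Y) * Q j = (x i - y j) • (P i * Q j) := by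
  rw [mul_sub, sub_mul, hP.right_mul, mul_assoc, hQ.left_mul, smul_mul_assoc, mul_smul_comm,
    sub_smul]

theorem eq_of_mul_ne_zero (hP : IsSpectralResolution X P x) (hQ : IsSpectralResolution X Q y)
    {i : ι} {j : κ} (h : P i * Q j ≠ 0) : x i = y j := by
  have h0 := hP.mul_sub_mul hQ i j
  rw [sub_self, mul_zero, zero_mul, eq_comm, smul_eq_zero] at h0
  exact sub_eq_zero.1 (h0.resolve_right h)

theorem exists_eq (hP : IsSpectralResolution X P x) (hQ : IsSpectralResolution X Q y)
    {j : κ} (h : Q j ≠ 0) : ∃ i, P i ≠ 0 ∧ x i = y j := by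
  by_contra! H
  refine h ?_
  rw [← one_mul (Q j), ← hP.sum_eq, Finset.sum_mul]
  refine Finset.sum_eq_zero fun i _ => ?_
  by_contra h0
  exact H i (fun h1 => h0 (by rw [h1, zero_mul])) (hP.eq_of_mul_ne_zero hQ h0)

theorem sum_mul_congr (hP : IsSpectralResolution X P x) (hQ : IsSpectralResolution X Q y)
    (G : ℝ → M) : ∑ i, P i * G (x i) = ∑ j, Q j * G (y j) := by
  calc ∑ i, P i * G (x i) = ∑ i, ∑ j, P i * Q j * G (x i) := by
        simp_rw [← Finset.sum_mul, ← Finset.mul_sum, hQ.sum_eq, mul_one]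
    _ = ∑ i, ∑ j, P i * Q j * G (y j) := by
        refine Finset.sum_congr rfl fun i _ => Finset.sum_congr rfl fun j _ => ?_
        by_cases h : P i * Q j = 0
        · simp [h]
        · rw [hP.eq_of_mul_ne_zero hQ h]
    _ = ∑ j, Q j * G (y j) := by
        rw [Finset.sum_comm]
        simp_rw [← Finset.sum_mul, hP.sum_eq, one_mul]

theorem sum_smul_congr (hP : IsSpectralResolution X P x) (hQ : IsSpectralResolution X Q y)
    (g : ℝ → ℝ) : ∑ i, g (x i) • P i = ∑ j, g (y j) • Q j := by
  simpa using hP.sum_mul_congr hQ fun r => g r • (1 : M)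

theorem sum_sum_congr (hP : IsSpectralResolution X P x) (hQ : IsSpectralResolution X Q y)
    {R : μ → M} {z : μ → ℝ} (φ : ℝ → ℝ → ℝ) (B : M) :
    ∑ i, ∑ j, φ (x i) (z j) • (P i * B * R j) = ∑ i, ∑ j, φ (y i) (z j) • (Q i * B * R j) := by
  simpa [Finset.mul_sum, mul_assoc] using
    hP.sum_mul_congr hQ fun r => ∑ j, φ r (z j) • (B * R j)

theorem sum_sum_sum_congr_left (hP : IsSpectralResolution X P x)
    (hQ : IsSpectralResolution X Q y) {ν : Type*} [Fintype ν] {R : μ → M} {z : μ → ℝ} {S : ν → M}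
    {w : ν → ℝ} (φ : ℝ → ℝ → ℝ → ℝ) (B C : M) :
    ∑ i, ∑ j, ∑ l, φ (x i) (z j) (w l) • (P i * B * R j * C * S l) =
      ∑ i, ∑ j, ∑ l, φ (y i) (z j) (w l) • (Q i * B * R j * C * S l) := by
  simpa [Finset.mul_sum, mul_assoc] using
    hP.sum_mul_congr hQ fun r => ∑ j, ∑ l, φ r (z j) (w l) • (B * R j * C * S l)

theorem sum_sum_sum_congr_middle (hP : IsSpectralResolution X P x)
    (hQ : IsSpectralResolution X Q y) {ν : Type*} [Fintype ν] {R : μ → M} {z : μ → ℝ} {S : ν → M}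
    {w : ν → ℝ} (φ : ℝ → ℝ → ℝ → ℝ) (B C : M) :
    ∑ i, ∑ j, ∑ l, φ (z i) (x j) (w l) • (R i * B * P j * C * S l) =
      ∑ i, ∑ j, ∑ l, φ (z i) (y j) (w l) • (R i * B * Q j * C * S l) := by
  refine Finset.sum_congr rfl fun i _ => ?_
  simpa [Finset.mul_sum, mul_assoc] using
    congrArg (fun m : M => R i * B * m) (hP.sum_mul_congr hQ fun r => ∑ l, φ (z i) r (w l) • (C * S l))

theorem sum_sum_sum_congr_right (hP : IsSpectralResolution X P x)
    (hQ : IsSpectralResolution X Q y) {ν : Type*} [Fintype ν] {R : μ → M} {z : μ → ℝ} {S : ν → M}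
    {w : ν → ℝ} (φ : ℝ → ℝ → ℝ → ℝ) (B C : M) :
    ∑ i, ∑ j, ∑ l, φ (z i) (w j) (x l) • (R i * B * S j * C * P l) =
      ∑ i, ∑ j, ∑ l, φ (z i) (w j) (y l) • (R i * B * S j * C * Q l) := by
  refine Finset.sum_congr rfl fun i _ => Finset.sum_congr rfl fun j _ => ?_
  simpa [Finset.mul_sum, mul_assoc] using
    congrArg (fun m : M => R i * B * S j * C * m) (hP.sum_smul_congr hQ fun r => φ (z i) (w j) r)

theorem sum_smul_sub_sum_smul (hP : IsSpectralResolution X P x)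
    (hQ : IsSpectralResolution Y Q y) (f : ℝ → ℝ) :
    ∑ i, f (x i) • P i - ∑ j, f (y j) • Q j =
      ∑ i, ∑ j, dd1 f (x i) (y j) • (P i * (X - Y) * Q j) := by
  simp_rw [hP.mul_sub_mul hQ, smul_smul, dd1_mul_sub, sub_smul, Finset.sum_sub_distrib]
  congr 1
  · simp_rw [← Finset.smul_sum, ← Finset.mul_sum, hQ.sum_eq, mul_one]
  · rw [Finset.sum_comm]
    simp_rw [← Finset.smul_sum, ← Finset.sum_mul, hP.sum_eq, one_mul]

theorem sum_dd1_sub_sum_dd1_right (hP : IsSpectralResolution X P x)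
    (hQ : IsSpectralResolution Y Q y) (f : ℝ → ℝ) (R : μ → M) (z : μ → ℝ) (B : M) :
    ∑ i, ∑ j, dd1 f (z i) (x j) • (R i * B * P j) -
        ∑ i, ∑ j, dd1 f (z i) (y j) • (R i * B * Q j) =
      ∑ i, ∑ j, ∑ l, dd2 f (z i) (x j) (y l) • (R i * B * P j * (X - Y) * Q l) := by
  rw [← Finset.sum_sub_distrib]
  refine Finset.sum_congr rfl fun i _ => ?_
  have h : ∀ j l, dd2 f (z i) (x j) (y l) • (R i * B * P j * (X - Y) * Q l) =
      dd1 f (z i) (x j) • (R i * B * (P j * Q l)) -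
        dd1 f (z i) (y l) • (R i * B * (P j * Q l)) := by
    intro j l
    rw [← sub_smul, ← dd2_mul_sub, mul_assoc (R i * B), mul_assoc (R i * B),
      hP.mul_sub_mul hQ, mul_smul_comm, smul_smul]
  simp_rw [h, Finset.sum_sub_distrib]
  congr 1
  · simp_rw [← Finset.smul_sum, ← Finset.mul_sum, hQ.sum_eq, mul_one]
  · rw [Finset.sum_comm]
    simp_rw [← Finset.smul_sum, ← Finset.mul_sum, ← Finset.sum_mul, hP.sum_eq, one_mul]

theorem sum_dd1_sub_sum_dd1_left (hP : IsSpectralResolution X P x)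
    (hQ : IsSpectralResolution Y Q y) (f : ℝ → ℝ) (R : μ → M) (z : μ → ℝ) (B : M) :
    ∑ i, ∑ l, dd1 f (x i) (z l) • (P i * B * R l) -
        ∑ j, ∑ l, dd1 f (y j) (z l) • (Q j * B * R l) =
      ∑ i, ∑ j, ∑ l, dd2 f (z l) (x i) (y j) • (P i * (X - Y) * Q j * B * R l) := by
  have h : ∀ i j l, dd2 f (z l) (x i) (y j) • (P i * (X - Y) * Q j * B * R l) =
      dd1 f (x i) (z l) • (P i * Q j * (B * R l)) -
        dd1 f (y j) (z l) • (P i * Q j * (B * R l)) := by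
    intro i j l
    rw [← sub_smul, dd1_comm f (x i), dd1_comm f (y j), ← dd2_mul_sub, hP.mul_sub_mul hQ,
      mul_assoc _ B, smul_mul_assoc, smul_smul]
  simp_rw [h, Finset.sum_sub_distrib]
  congr 1
  · refine Finset.sum_congr rfl fun i _ => ?_
    rw [Finset.sum_comm]
    simp_rw [← Finset.smul_sum, ← Finset.sum_mul, ← Finset.mul_sum, hQ.sum_eq, mul_one, mul_assoc]
  · rw [eq_comm, Finset.sum_comm]
    refine Finset.sum_congr rfl fun j _ => ?_
    rw [Finset.sum_comm]
    simp_rw [← Finset.smul_sum, ← Finset.sum_mul, hP.sum_eq, one_mul, mul_assoc]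

end IsSpectralResolution

section Diagonalization

variable {k : ℕ}

theorem isCompact_unitaryGroup :
    IsCompact (Matrix.unitaryGroup (Fin k) ℂ : Set (Matrix (Fin k) (Fin k) ℂ)) := by
  have hK : IsCompact (Set.univ.pi fun _ => Set.univ.pi fun _ => Metric.closedBall 0 1 :
      Set (Matrix (Fin k) (Fin k) ℂ)) :=
    isCompact_univ_pi fun _ => isCompact_univ_pi fun _ => isCompact_closedBall 0 1
  refine IsCompact.of_isClosed_subset hK (isClosed_unitary (R := Matrix (Fin k) (Fin k) ℂ))
    fun U hU i _ j _ => ?_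
  rw [mem_closedBall_zero_iff]
  exact entry_norm_bound_of_unitary hU i j

theorem diagonal_mul_single (d : Fin k → ℝ) (i : Fin k) :
    (Matrix.diagonal fun i => (d i : ℂ)) * Matrix.single i i 1 =
      d i • Matrix.single i i (1 : ℂ) := by
  ext a b
  rw [Matrix.diagonal_mul, Matrix.smul_apply, Complex.real_smul]
  by_cases h : i = a
  · rw [h]
  · simp [h]

theorem single_mul_diagonal (d : Fin k → ℝ) (i : Fin k) :
    Matrix.single i i 1 * (Matrix.diagonal fun i => (d i : ℂ)) =
      d i • Matrix.single i i (1 : ℂ) := by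
  ext a b
  rw [Matrix.mul_diagonal, Matrix.smul_apply, Complex.real_smul, mul_comm]
  by_cases h : i = b
  · rw [h]
  · simp [h]

/-- The rank-one projection onto the `i`-th column of a unitary matrix. -/
noncomputable def colProj (U : Matrix (Fin k) (Fin k) ℂ) (i : Fin k) :
    Matrix (Fin k) (Fin k) ℂ :=
  U * Matrix.single i i 1 * star U

theorem continuous_colProj (i : Fin k) :
    Continuous fun U : Matrix (Fin k) (Fin k) ℂ => colProj U i := by
  unfold colProj
  fun_prop

theorem colProj_ne_zero {U : Matrix (Fin k) (Fin k) ℂ} (hU : U ∈ Matrix.unitaryGroup (Fin k) ℂ)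
    (i : Fin k) : colProj U i ≠ 0 := by
  intro h
  have h1 : star U * colProj U i * U = Matrix.single i i 1 := by
    rw [colProj, mul_assoc, mul_assoc, mul_assoc, Unitary.star_mul_self_of_mem hU, mul_one,
      ← mul_assoc, Unitary.star_mul_self_of_mem hU, one_mul]
  rw [h, mul_zero, zero_mul] at h1
  simpa using congrFun (congrFun h1 i) i

theorem isSpectralResolution_colProj {U X : Matrix (Fin k) (Fin k) ℂ} {d : Fin k → ℝ}
    (hU : U ∈ Matrix.unitaryGroup (Fin k) ℂ)
    (hd : star U * X * U = Matrix.diagonal fun i => (d i : ℂ)) :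
    IsSpectralResolution X (colProj U) d := by
  have h1 := Unitary.star_mul_self_of_mem hU
  have h2 := Unitary.mul_star_self_of_mem hU
  have hX : X * U = U * Matrix.diagonal fun i => (d i : ℂ) := by
    rw [← hd, ← mul_assoc, ← mul_assoc, h2, one_mul]
  have hX' : star U * X = (Matrix.diagonal fun i => (d i : ℂ)) * star U := by
    rw [← hd, mul_assoc, h2, mul_one]
  refine ⟨fun i j => ?_, ?_, fun i => ?_, fun i => ?_⟩
  · have : colProj U i * colProj U j =
        U * (Matrix.single i i 1 * Matrix.single j j 1) * star U := by
      rw [colProj, colProj, mul_assoc (U * _), ← mul_assoc (star U), ← mul_assoc (star U), h1,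
        one_mul]
      simp only [mul_assoc]
    rw [this]
    split_ifs with h
    · subst h
      rw [Matrix.single_mul_single_same, mul_one, colProj]
    · rw [Matrix.single_mul_single_of_ne _ _ _ _ h, mul_zero, zero_mul]
  · simp_rw [colProj]
    rw [← Finset.sum_mul, ← Finset.mul_sum, Matrix.sum_single_one, mul_one, h2]
  · rw [colProj, ← mul_assoc, ← mul_assoc, hX, mul_assoc U, diagonal_mul_single, mul_smul_comm,
      smul_mul_assoc]
  · rw [colProj, mul_assoc _ _ X, hX', ← mul_assoc, mul_assoc U, single_mul_diagonal, mul_smul_comm,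
      smul_mul_assoc]

theorem exists_tendsto_diagonalization {α : Type*} (𝓤 : Ultrafilter α)
    {U X : α → Matrix (Fin k) (Fin k) ℂ} {d : α → Fin k → ℝ} {X₀ : Matrix (Fin k) (Fin k) ℂ}
    (hU : ∀ a, U a ∈ Matrix.unitaryGroup (Fin k) ℂ)
    (hd : ∀ a, star (U a) * X a * U a = Matrix.diagonal fun i => (d a i : ℂ))
    (hX : Tendsto X 𝓤 (𝓝 X₀)) :
    ∃ V ∈ Matrix.unitaryGroup (Fin k) ℂ, ∃ y : Fin k → ℝ,
      (star V * X₀ * V = Matrix.diagonal fun i => (y i : ℂ)) ∧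
      Tendsto U 𝓤 (𝓝 V) ∧ ∀ i, Tendsto (fun a => d a i) 𝓤 (𝓝 (y i)) := by
  obtain ⟨V, hV, hUV⟩ := isCompact_unitaryGroup.ultrafilter_le_nhds (𝓤.map U)
    (tendsto_principal.2 (Filter.Eventually.of_forall hU))
  have hUV : Tendsto U 𝓤 (𝓝 V) := hUV
  have hlim : Tendsto (fun a => star (U a) * X a * U a) 𝓤 (𝓝 (star V * X₀ * V)) :=
    (hUV.star.mul hX).mul hUV
  have hy : ∀ i, Tendsto (fun a => d a i) 𝓤 (𝓝 ((star V * X₀ * V) i i).re) := by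
    intro i
    have h : Tendsto (fun a => ((star (U a) * X a * U a) i i).re) 𝓤
        (𝓝 ((star V * X₀ * V) i i).re) :=
      (Complex.continuous_re.tendsto _).comp
        (((continuous_apply_apply i i).tendsto (star V * X₀ * V)).comp hlim)
    simpa only [hd, Matrix.diagonal_apply_eq, Complex.ofReal_re] using h
  refine ⟨V, hV, _, tendsto_nhds_unique hlim ?_, hUV, hy⟩
  simp_rw [hd]
  refine Tendsto.comp (f := fun a i => ((d a i : ℝ) : ℂ))
    (Continuous.matrix_diagonal continuous_id).continuousAt ?_
  exact tendsto_pi_nhds.2 fun i => (Complex.continuous_ofReal.tendsto _).comp (hy i)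

theorem hasDerivAt_of_sub_eq_smul {F G : ℝ → Matrix (Fin k) (Fin k) ℂ}
    {L : Matrix (Fin k) (Fin k) ℂ} {t : ℝ} (hF : ∀ s, F s - F t = (s - t) • G s)
    (hG : Tendsto G (𝓝 t) (𝓝 L)) : HasDerivAt F L t := by
  refine hasDerivAt_iff_tendsto_slope.2 ((hG.mono_left nhdsWithin_le_nhds).congr' ?_)
  filter_upwards [self_mem_nhdsWithin] with s hs
  rw [slope_def_module, hF, smul_smul, inv_mul_cancel₀ (sub_ne_zero.2 hs), one_smul]

theorem tendsto_sum_sum {α ι κ : Type*} [Fintype ι] [Fintype κ] {l : Filter α}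
    {φ : ℝ → ℝ → ℝ} (hφ : Continuous fun p : ℝ × ℝ => φ p.1 p.2)
    {x : α → ι → ℝ} {y : α → κ → ℝ} {P : α → ι → Matrix (Fin k) (Fin k) ℂ}
    {Q : α → κ → Matrix (Fin k) (Fin k) ℂ} {x₀ : ι → ℝ} {y₀ : κ → ℝ}
    {P₀ : ι → Matrix (Fin k) (Fin k) ℂ} {Q₀ : κ → Matrix (Fin k) (Fin k) ℂ}
    (hx : ∀ i, Tendsto (fun a => x a i) l (𝓝 (x₀ i)))
    (hy : ∀ i, Tendsto (fun a => y a i) l (𝓝 (y₀ i)))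
    (hP : ∀ i, Tendsto (fun a => P a i) l (𝓝 (P₀ i)))
    (hQ : ∀ i, Tendsto (fun a => Q a i) l (𝓝 (Q₀ i))) (B : Matrix (Fin k) (Fin k) ℂ) :
    Tendsto (fun a => ∑ i, ∑ j, φ (x a i) (y a j) • (P a i * B * Q a j)) l
      (𝓝 (∑ i, ∑ j, φ (x₀ i) (y₀ j) • (P₀ i * B * Q₀ j))) :=
  tendsto_finsetSum _ fun i _ => tendsto_finsetSum _ fun j _ =>
    ((hφ.tendsto (x₀ i, y₀ j)).comp ((hx i).prodMk_nhds (hy j))).smul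
      (((hP i).mul tendsto_const_nhds).mul (hQ j))

theorem tendsto_sum_sum_sum {α ι κ μ : Type*} [Fintype ι] [Fintype κ] [Fintype μ] {l : Filter α}
    {φ : ℝ → ℝ → ℝ → ℝ} (hφ : Continuous fun p : ℝ × ℝ × ℝ => φ p.1 p.2.1 p.2.2)
    {x : α → ι → ℝ} {y : α → κ → ℝ} {z : α → μ → ℝ} {P : α → ι → Matrix (Fin k) (Fin k) ℂ}
    {Q : α → κ → Matrix (Fin k) (Fin k) ℂ} {R : α → μ → Matrix (Fin k) (Fin k) ℂ}
    {x₀ : ι → ℝ} {y₀ : κ → ℝ} {z₀ : μ → ℝ} {P₀ : ι → Matrix (Fin k) (Fin k) ℂ}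
    {Q₀ : κ → Matrix (Fin k) (Fin k) ℂ} {R₀ : μ → Matrix (Fin k) (Fin k) ℂ}
    (hx : ∀ i, Tendsto (fun a => x a i) l (𝓝 (x₀ i)))
    (hy : ∀ i, Tendsto (fun a => y a i) l (𝓝 (y₀ i)))
    (hz : ∀ i, Tendsto (fun a => z a i) l (𝓝 (z₀ i)))
    (hP : ∀ i, Tendsto (fun a => P a i) l (𝓝 (P₀ i)))
    (hQ : ∀ i, Tendsto (fun a => Q a i) l (𝓝 (Q₀ i)))
    (hR : ∀ i, Tendsto (fun a => R a i) l (𝓝 (R₀ i))) (B C : Matrix (Fin k) (Fin k) ℂ) :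
    Tendsto (fun a => ∑ i, ∑ j, ∑ m,
        φ (x a i) (y a j) (z a m) • (P a i * B * Q a j * C * R a m)) l
      (𝓝 (∑ i, ∑ j, ∑ m, φ (x₀ i) (y₀ j) (z₀ m) • (P₀ i * B * Q₀ j * C * R₀ m))) :=
  tendsto_finsetSum _ fun i _ => tendsto_finsetSum _ fun j _ => tendsto_finsetSum _ fun m _ =>
    ((hφ.tendsto (x₀ i, y₀ j, z₀ m)).comp ((hx i).prodMk_nhds ((hy j).prodMk_nhds (hz m)))).smul
      (((((hP i).mul tendsto_const_nhds).mul (hQ j)).mul tendsto_const_nhds).mul (hR m))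

end Diagonalization

section Pencil

variable {k : ℕ} {A B : Matrix (Fin k) (Fin k) ℂ} {U : ℝ → Matrix (Fin k) (Fin k) ℂ}
  {d : ℝ → Fin k → ℝ} {f : ℝ → ℝ}

theorem tendsto_add_smul (A B : Matrix (Fin k) (Fin k) ℂ) (t : ℝ) :
    Tendsto (fun s : ℝ => A + s • B) (𝓝 t) (𝓝 (A + t • B)) :=
  tendsto_const_nhds.add (tendsto_id.smul_const B)

theorem add_smul_sub_add_smul (A B : Matrix (Fin k) (Fin k) ℂ) (s t : ℝ) :
    A + s • B - (A + t • B) = (s - t) • B := by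
  rw [add_sub_add_left_eq_sub, sub_smul]

theorem hasDerivAt_sum_smul_colProj (hf : ContDiff ℝ 1 f)
    (hU : ∀ t, U t ∈ Matrix.unitaryGroup (Fin k) ℂ)
    (hd : ∀ t, star (U t) * (A + t • B) * U t = Matrix.diagonal fun i => (d t i : ℂ)) (t : ℝ) :
    HasDerivAt (fun s => ∑ i, f (d s i) • colProj (U s) i)
      (∑ i, ∑ j, dd1 f (d t i) (d t j) • (colProj (U t) i * B * colProj (U t) j)) t := by
  have hP := fun s => isSpectralResolution_colProj (hU s) (hd s)
  refine hasDerivAt_of_sub_eq_smul (G := fun s =>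
    ∑ i, ∑ j, dd1 f (d s i) (d t j) • (colProj (U s) i * B * colProj (U t) j)) (fun s => ?_) ?_
  · rw [(hP s).sum_smul_sub_sum_smul (hP t) f, add_smul_sub_add_smul]
    simp_rw [mul_smul_comm, smul_mul_assoc, Finset.smul_sum, smul_comm (s - t)]
  · rw [tendsto_iff_ultrafilter]
    intro 𝓤 h𝓤
    obtain ⟨V, hV, y, hy, hUV, hdy⟩ := exists_tendsto_diagonalization 𝓤 hU hd
      ((tendsto_add_smul A B t).mono_left h𝓤)
    rw [(hP t).sum_sum_congr (isSpectralResolution_colProj hV hy)]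
    exact tendsto_sum_sum (l := (𝓤 : Filter ℝ)) (x := d) (y := fun _ => d t)
      (P := fun s => colProj (U s)) (Q := fun _ => colProj (U t)) (continuous_dd1 hf) hdy
      (fun _ => tendsto_const_nhds) (fun i => ((continuous_colProj i).tendsto V).comp hUV)
      (fun _ => tendsto_const_nhds) B

theorem hasDerivAt_sum_dd1_smul_colProj (hf : ContDiff ℝ 2 f)
    (hU : ∀ t, U t ∈ Matrix.unitaryGroup (Fin k) ℂ)
    (hd : ∀ t, star (U t) * (A + t • B) * U t = Matrix.diagonal fun i => (d t i : ℂ)) (t : ℝ) :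
    HasDerivAt
      (fun s => ∑ i, ∑ j, dd1 f (d s i) (d s j) • (colProj (U s) i * B * colProj (U s) j))
      ((2 : ℝ) • ∑ i, ∑ j, ∑ l, dd2 f (d t i) (d t j) (d t l) •
        (colProj (U t) i * B * colProj (U t) j * B * colProj (U t) l)) t := by
  have hP := fun s => isSpectralResolution_colProj (hU s) (hd s)
  refine hasDerivAt_of_sub_eq_smul (G := fun s =>
    ∑ i, ∑ j, ∑ l, dd2 f (d s i) (d s j) (d t l) •
        (colProj (U s) i * B * colProj (U s) j * B * colProj (U t) l) +
      ∑ i, ∑ j, ∑ l, dd2 f (d s i) (d t j) (d t l) •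
        (colProj (U s) i * B * colProj (U t) j * B * colProj (U t) l)) (fun s => ?_) ?_
  · rw [← sub_add_sub_cancel, (hP s).sum_dd1_sub_sum_dd1_right (hP t),
      (hP s).sum_dd1_sub_sum_dd1_left (hP t), add_smul_sub_add_smul]
    simp_rw [mul_smul_comm, smul_mul_assoc, smul_add, Finset.smul_sum, smul_comm (s - t)]
    refine congrArg _ (Finset.sum_congr rfl fun i _ => Finset.sum_congr rfl fun j _ =>
      Finset.sum_congr rfl fun l _ => ?_)
    rw [dd2_rotate hf (d s i)]
  · rw [tendsto_iff_ultrafilter]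
    intro 𝓤 h𝓤
    obtain ⟨V, hV, y, hy, hUV, hdy⟩ := exists_tendsto_diagonalization 𝓤 hU hd
      ((tendsto_add_smul A B t).mono_left h𝓤)
    have hQ := isSpectralResolution_colProj hV hy
    have hPV : ∀ i, Tendsto (fun s => colProj (U s) i) 𝓤 (𝓝 (colProj V i)) :=
      fun i => ((continuous_colProj i).tendsto V).comp hUV
    rw [two_smul]
    refine Tendsto.add ?_ ?_
    · rw [(hP t).sum_sum_sum_congr_left hQ, (hP t).sum_sum_sum_congr_middle hQ]
      exact tendsto_sum_sum_sum (l := (𝓤 : Filter ℝ)) (x := d) (y := d) (z := fun _ => d t)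
        (P := fun s => colProj (U s)) (Q := fun s => colProj (U s)) (R := fun _ => colProj (U t))
        (continuous_dd2 hf) hdy hdy (fun _ => tendsto_const_nhds) hPV hPV
        (fun _ => tendsto_const_nhds) B B
    · rw [(hP t).sum_sum_sum_congr_left hQ]
      exact tendsto_sum_sum_sum (l := (𝓤 : Filter ℝ)) (x := d) (y := fun _ => d t)
        (z := fun _ => d t) (P := fun s => colProj (U s)) (Q := fun _ => colProj (U t))
        (R := fun _ => colProj (U t)) (continuous_dd2 hf) hdy (fun _ => tendsto_const_nhds)
        (fun _ => tendsto_const_nhds) hPV (fun _ => tendsto_const_nhds)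
        (fun _ => tendsto_const_nhds) B B

/-- The eigenvalues of `A + s • B` are eventually close to those of `A + t • B`. -/
theorem eventually_forall_mem (hU : ∀ t, U t ∈ Matrix.unitaryGroup (Fin k) ℂ)
    (hd : ∀ t, star (U t) * (A + t • B) * U t = Matrix.diagonal fun i => (d t i : ℂ)) (t : ℝ)
    {N : Set ℝ} (hN : ∀ i, N ∈ 𝓝 (d t i)) : ∀ᶠ s in 𝓝 t, ∀ i, d s i ∈ N := by
  rw [Filter.Eventually, mem_iff_ultrafilter]
  intro 𝓤 h𝓤
  obtain ⟨V, hV, y, hy, hUV, hdy⟩ := exists_tendsto_diagonalization 𝓤 hU hd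
    ((tendsto_add_smul A B t).mono_left h𝓤)
  refine Filter.eventually_all.2 fun i => (hdy i).eventually ?_
  obtain ⟨j, -, hj⟩ := (isSpectralResolution_colProj (hU t) (hd t)).exists_eq
    (isSpectralResolution_colProj hV hy) (colProj_ne_zero hV i)
  rw [← hj]
  exact hN j

end Pencil

open scoped Manifold in
/-- A function that is `C^2` on a neighbourhood of a closed set agrees near that set with a
globally `C^2` function. -/
theorem exists_contDiff_eventuallyEq {f : ℝ → ℝ} {Ω K : Set ℝ} (hΩ : IsOpen Ω)
    (hf : ContDiffOn ℝ 2 f Ω) (hK : IsClosed K) (hKΩ : K ⊆ Ω) :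
    ∃ g : ℝ → ℝ, ContDiff ℝ 2 g ∧ ∀ᶠ x in 𝓝ˢ K, g x = f x := by
  obtain ⟨χ, h0, h1, -⟩ := exists_contMDiffMap_zero_one_nhds_of_isClosed 𝓘(ℝ, ℝ) (n := 2)
    hΩ.isClosed_compl hK (Set.disjoint_compl_left_iff_subset.2 hKΩ)
  have hχ : ContDiff ℝ 2 χ := χ.contMDiff.contDiff
  refine ⟨fun x => χ x * f x, contDiff_iff_contDiffAt.2 fun x => ?_, ?_⟩
  · by_cases hx : x ∈ Ω
    · exact hχ.contDiffAt.mul (hf.contDiffAt (hΩ.mem_nhds hx))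
    · refine contDiffAt_const (c := (0 : ℝ)) |>.congr_of_eventuallyEq ?_
      filter_upwards [eventually_nhdsSet_iff_forall.1 h0 x hx] with y hy
      rw [hy, zero_mul]
  · filter_upwards [h1] with x hx
    rw [hx, one_mul]

theorem dd1_congr {f g : ℝ → ℝ} {r s : ℝ} (hr : f =ᶠ[𝓝 r] g) (hs : f s = g s) :
    dd1 f r s = dd1 g r s := by
  rw [dd1, dd1, hr.deriv_eq, hr.eq_of_nhds, hs]

theorem dd2_congr {f g : ℝ → ℝ} {r s t : ℝ} (hr : f =ᶠ[𝓝 r] g) (hs : f =ᶠ[𝓝 s] g)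
    (ht : f t = g t) : dd2 f r s t = dd2 g r s t := by
  have h : (fun x => dd1 f r x) =ᶠ[𝓝 s] fun x => dd1 g r x := hs.mono fun x hx => dd1_congr hr hx
  rw [dd2, dd2, h.deriv_eq, dd1_congr hr hs.eq_of_nhds, dd1_congr hr ht]

theorem hermApply_eq_sum {k : ℕ} {A : Matrix (Fin k) (Fin k) ℂ} (hA : A.IsHermitian)
    (f : ℝ → ℝ) :
    hermApply f hA = ∑ i, f (hA.eigenvalues i) •
      colProj (hA.eigenvectorUnitary : Matrix (Fin k) (Fin k) ℂ) i := by
  have h : (Matrix.diagonal fun i => (f (hA.eigenvalues i) : ℂ)) =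
      ∑ i, f (hA.eigenvalues i) • Matrix.single i i (1 : ℂ) := by
    rw [← mul_one (Matrix.diagonal _), ← Matrix.sum_single_one, Finset.mul_sum]
    exact Finset.sum_congr rfl fun i _ => diagonal_mul_single (fun i => f (hA.eigenvalues i)) i
  simp_rw [hermApply, h, colProj, Finset.mul_sum, Finset.sum_mul, mul_smul_comm, smul_mul_assoc]

/-- Daleckii–Krein type formula (second derivative): if `A, B` are self-adjoint,
`f` is twice continuously differentiable on an open set `Ω` containing the spectrum of
`A + tB` for all sufficiently small `|t|`, and `A = Σ_i λ_i E_i` is the spectral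
decomposition of `A` (`λ` injective, `E_i` pairwise-orthogonal Hermitian projections summing
to `1`), then `t ↦ f(A + tB)` is twice differentiable at `t = 0` with
`(d²/dt²)|_{t=0} f(A + tB) = 2 Σ_{i,j,k} f^{[2]}(λ_i, λ_j, λ_k) E_i B E_j B E_k`. -/
theorem second_deriv_hermApply {k : ℕ} {A B : Matrix (Fin k) (Fin k) ℂ}
    (hA : A.IsHermitian) (hB : B.IsHermitian)
    (f : ℝ → ℝ) (Ω : Set ℝ) (hΩ : IsOpen Ω) (hf : ContDiffOn ℝ 2 f Ω)
    (ε : ℝ) (hε : 0 < ε)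
    (hspec : ∀ t : ℝ, |t| < ε → ∀ i, (isHermitian_add_smul hA hB t).eigenvalues i ∈ Ω)
    {ι : Type*} [Fintype ι] [DecidableEq ι] (lam : ι → ℝ) (hlam : Function.Injective lam)
    (E : ι → Matrix (Fin k) (Fin k) ℂ) (hE : ∀ i, (E i).IsHermitian)
    (hEE : ∀ i j, E i * E j = if i = j then E i else 0)
    (hEsum : ∑ i, E i = 1) (hAE : A = ∑ i, lam i • E i) :
    (∀ᶠ t in nhds (0 : ℝ), DifferentiableAt ℝ
      (fun t : ℝ => hermApply f (isHermitian_add_smul hA hB t)) t) ∧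
    DifferentiableAt ℝ
      (deriv fun t : ℝ => hermApply f (isHermitian_add_smul hA hB t)) 0 ∧
    deriv (deriv fun t : ℝ => hermApply f (isHermitian_add_smul hA hB t)) 0 =
      (2 : ℂ) • ∑ i, ∑ j, ∑ l,
        (dd2 f (lam i) (lam j) (lam l) : ℂ) • (E i * B * E j * B * E l) := by
  set U : ℝ → Matrix (Fin k) (Fin k) ℂ := fun t =>
    ((isHermitian_add_smul hA hB t).eigenvectorUnitary : Matrix (Fin k) (Fin k) ℂ)
  set d : ℝ → Fin k → ℝ := fun t => (isHermitian_add_smul hA hB t).eigenvalues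
  have hU : ∀ t, U t ∈ Matrix.unitaryGroup (Fin k) ℂ := fun t =>
    (isHermitian_add_smul hA hB t).eigenvectorUnitary.2
  have hd : ∀ t, star (U t) * (A + t • B) * U t = Matrix.diagonal fun i => (d t i : ℂ) := fun t =>
    (Unitary.conjStarAlgAut_star_apply _ _).symm.trans
      (isHermitian_add_smul hA hB t).conjStarAlgAut_star_eigenvectorUnitary
  have hP : IsSpectralResolution A (colProj (U 0)) (d 0) :=
    isSpectralResolution_colProj (hU 0) (by simpa using hd 0)
  have hQ : IsSpectralResolution A E lam := .of_eq_sum hEE hEsum hAE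
  obtain ⟨g, hg, hgf⟩ := exists_contDiff_eventuallyEq hΩ hf (Set.finite_range (d 0)).isClosed
    (Set.range_subset_iff.2 (hspec 0 (by simpa using hε)))
  have hgf' : ∀ i, f =ᶠ[𝓝 (d 0 i)] g := fun i =>
    (eventually_nhdsSet_iff_forall.1 hgf _ (Set.mem_range_self i)).mono fun _ h => h.symm
  have hF : (fun t => hermApply f (isHermitian_add_smul hA hB t)) =ᶠ[𝓝 0]
      fun t => ∑ i, g (d t i) • colProj (U t) i := by
    filter_upwards [eventually_forall_mem hU hd 0 hgf'] with t ht
    rw [hermApply_eq_sum]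
    exact Finset.sum_congr rfl fun i _ => by rw [← show f (d t i) = g (d t i) from ht i]
  have h1 := hasDerivAt_sum_smul_colProj (hg.of_le one_le_two) hU hd
  have h2 := hasDerivAt_sum_dd1_smul_colProj hg hU hd 0
  have hD : deriv (fun t => hermApply f (isHermitian_add_smul hA hB t)) =ᶠ[𝓝 0] _ :=
    hF.deriv.trans (Eventually.of_forall fun t => (h1 t).deriv)
  have h3 := h2.congr_of_eventuallyEq hD
  refine ⟨hF.eventually_nhds.mono fun t ht => ((h1 t).congr_of_eventuallyEq ht).differentiableAt,
    h3.differentiableAt, h3.deriv.trans ?_⟩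
  rw [hP.sum_sum_sum_congr_left hQ, hP.sum_sum_sum_congr_middle hQ,
    hP.sum_sum_sum_congr_right hQ]
  have hlam' : ∀ i, E i ≠ 0 → f =ᶠ[𝓝 (lam i)] g := by
    intro i hi
    obtain ⟨j, -, hj⟩ := hP.exists_eq hQ hi
    exact hj ▸ hgf' j
  rw [← Complex.coe_smul, Complex.ofReal_ofNat]
  refine congrArg _ (Finset.sum_congr rfl fun i _ => Finset.sum_congr rfl fun j _ =>
    Finset.sum_congr rfl fun l _ => ?_)
  by_cases hi : E i = 0
  · simp [hi]
  by_cases hj : E j = 0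
  · simp [hj]
  by_cases hl : E l = 0
  · simp [hl]
  rw [dd2_congr (hlam' i hi) (hlam' j hj) (hlam' l hl).eq_of_nhds, Complex.coe_smul]
end
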